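/- Let λ > 0 and define u : [0,∞) × [0,1] → ℝ by u(t,s) := (t−1) + (1/λ) Σ_{n ≥ 1, n odd} (−8)(nπ)^{−4} (1 − e^{−λ(nπ)² t}) cos(nπ s). Then: (i) the series converges (absolutely and uniformly in s) for every t ≥ 0, and u(0,s) = −1 for all s ∈ [0,1]; (ii) for every t > 0, u(t,·) is twice continuously differentiable in s on [0,1] and u(·,s) is differentiable in t, and the heat equation with inhomogeneity ∂_t u(t,s) − λ ∂²_{ss} u(t,s) = 2s holds for all t > 0 and s ∈ (0,1); (iii) the homogeneous Neumann boundary conditions ∂_s u(t,0) = ∂_s u(t,1) = 0 hold for all t > 0. -/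

import Mathlib

open Real Set Filter
open scoped Topology

noncomputable section

/-- The `k`-th term (corresponding to the odd integer `n = 2k+1`) of the Fourier cosine series
`(-8)(nπ)⁻⁴ (1 - e^{-λ(nπ)²t}) cos(nπs)`. -/
def serTerm (lam t s : ℝ) (k : ℕ) : ℝ :=
  (-8) / (((2*(k:ℝ)+1) * π)^4) * (1 - Real.exp (-(lam * ((2*(k:ℝ)+1) * π)^2 * t)))
    * Real.cos ((2*(k:ℝ)+1) * π * s)

/-- The explicit solution `u(t,s) = (t-1) + (1/λ) Σ_{n odd} (-8)(nπ)⁻⁴(1-e^{-λ(nπ)²t})cos(nπs)`. -/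
def uSol (lam t s : ℝ) : ℝ := (t - 1) + (1/lam) * ∑' k : ℕ, serTerm lam t s k

/-- Termwise differentiation of a cosine series. -/
lemma hasDerivAt_tsum_mul_cos {c a : ℕ → ℝ} (hc : Summable fun k => |c k|)
    (hca : Summable fun k => |c k * a k|) (s : ℝ) :
    HasDerivAt (fun x => ∑' k, c k * cos (a k * x)) (∑' k, -(c k * a k) * sin (a k * s)) s := by
  refine hasDerivAt_tsum (y₀ := 0) (g' := fun k x => -(c k * a k) * sin (a k * x)) hca
    (fun k x => ?_) (fun k x => ?_) (by simpa using hc.of_abs) s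
  · convert! (((hasDerivAt_id x).const_mul (a k)).cos.const_mul (c k)) using 1
    simp only [id_eq]
    ring
  · rw [norm_eq_abs, abs_mul, abs_neg]
    exact mul_le_of_le_one_right (abs_nonneg _) (abs_sin_le_one _)

/-- Termwise differentiation of a sine series. -/
lemma hasDerivAt_tsum_mul_sin {c a : ℕ → ℝ} (hca : Summable fun k => |c k * a k|) (s : ℝ) :
    HasDerivAt (fun x => ∑' k, c k * sin (a k * x)) (∑' k, c k * a k * cos (a k * s)) s := by
  refine hasDerivAt_tsum (y₀ := 0) (g' := fun k x => c k * a k * cos (a k * x)) hca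
    (fun k x => ?_) (fun k x => ?_) (by simp) s
  · convert! (((hasDerivAt_id x).const_mul (a k)).sin.const_mul (c k)) using 1
    simp only [id_eq]
    ring
  · rw [norm_eq_abs, abs_mul]
    exact mul_le_of_le_one_right (abs_nonneg _) (abs_cos_le_one _)

lemma continuous_tsum_mul_cos {c a : ℕ → ℝ} (hc : Summable fun k => |c k|) :
    Continuous fun x => ∑' k, c k * cos (a k * x) := by
  refine continuous_tsum (fun k => by fun_prop) hc fun k x => ?_
  rw [norm_eq_abs, abs_mul]
  exact mul_le_of_le_one_right (abs_nonneg _) (abs_cos_le_one _)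

/-- The odd frequencies `(2k+1)π`. -/
def oddFreq (k : ℕ) : ℝ := (2 * (k : ℝ) + 1) * π

lemma one_le_oddFreq (k : ℕ) : 1 ≤ oddFreq k := by
  have := pi_gt_three
  have hk : (0 : ℝ) ≤ k := k.cast_nonneg
  unfold oddFreq
  nlinarith

lemma oddFreq_pos (k : ℕ) : 0 < oddFreq k := one_pos.trans_le (one_le_oddFreq k)

/-- The Fourier cosine series of `(1 - 2s)/8` on `[0,1]`. -/
lemma hasSum_cos_oddFreq {s : ℝ} (hs : s ∈ Icc (0 : ℝ) 1) :
    HasSum (fun k => 1 / oddFreq k ^ 2 * cos (oddFreq k * s)) ((1 - 2 * s) / 8) := by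
  have hbernoulli (x : ℝ) :
      (Polynomial.map (algebraMap ℚ ℝ) (Polynomial.bernoulli 2)).eval x = x ^ 2 - x + 1 / 6 := by
    rw [← bernoulliFun, bernoulliFun_two]
    ring
  have hall := hasSum_one_div_nat_pow_mul_cos one_ne_zero (x := s / 2)
    ⟨by linarith [hs.1], by linarith [hs.2]⟩
  have heven := (hasSum_one_div_nat_pow_mul_cos one_ne_zero hs).mul_left (1 / 4)
  simp only [mul_one, hbernoulli] at hall heven
  have hodd := (hall.summable.comp_injective (i := fun k : ℕ => 2 * k + 1)
    (fun x y h => by simpa using h)).hasSum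
  have hterm (k : ℕ) : 1 / 4 * (1 / (k : ℝ) ^ 2 * cos (2 * π * k * s)) =
      1 / ((2 * k : ℕ) : ℝ) ^ 2 * cos (2 * π * ((2 * k : ℕ) : ℝ) * (s / 2)) := by
    push_cast
    rw [show 2 * π * (2 * (k : ℝ)) * (s / 2) = 2 * π * k * s by ring, mul_pow, ← mul_assoc,
      one_div_mul_one_div]
    norm_num
  simp only [hterm] at heven
  have hval := (HasSum.even_add_odd (f := fun n : ℕ => 1 / (n : ℝ) ^ 2 * cos (2 * π * n * (s / 2)))
    heven hodd).unique hall
  rw [eq_sub_of_add_eq' hval] at hodd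
  convert! hodd.mul_left (1 / π ^ 2) using 1
  · ext k
    simp only [Function.comp_apply, oddFreq]
    push_cast
    rw [show 2 * π * (2 * (k : ℝ) + 1) * (s / 2) = (2 * k + 1) * π * s by ring, mul_pow]
    field_simp
  · norm_num
    field_simp
    ring

lemma summable_one_div_oddFreq_pow {m : ℕ} (hm : 2 ≤ m) :
    Summable fun k => 1 / oddFreq k ^ m := by
  have h2 : Summable fun k => 1 / oddFreq k ^ 2 := by
    simpa using (hasSum_cos_oddFreq (s := 0) (by simp)).summable
  refine h2.of_nonneg_of_le (fun k => by have := oddFreq_pos k; positivity) fun k => ?_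
  have := oddFreq_pos k
  exact one_div_le_one_div_of_le (by positivity) (pow_le_pow_right₀ (one_le_oddFreq k) hm)

/-- The Fourier coefficients of `uSol`. -/
def serCoeff (lam t : ℝ) (k : ℕ) : ℝ :=
  (-8) / oddFreq k ^ 4 * (1 - exp (-(lam * oddFreq k ^ 2 * t)))

lemma serTerm_eq (lam t s : ℝ) (k : ℕ) :
    serTerm lam t s k = serCoeff lam t k * cos (oddFreq k * s) := rfl

section Coefficients

variable {lam t : ℝ}

lemma abs_serCoeff_le (hlam : 0 ≤ lam) (ht : 0 ≤ t) (k : ℕ) :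
    |serCoeff lam t k| ≤ 8 * (1 / oddFreq k ^ 4) := by
  have := oddFreq_pos k
  have h1 : exp (-(lam * oddFreq k ^ 2 * t)) ≤ 1 := by
    rw [exp_le_one_iff, neg_nonpos]
    positivity
  have h0 := exp_pos (-(lam * oddFreq k ^ 2 * t))
  rw [serCoeff, abs_mul, abs_div, abs_neg, abs_of_pos (by positivity : 0 < oddFreq k ^ 4),
    abs_of_nonneg (sub_nonneg.2 h1), abs_of_pos (by norm_num : (0 : ℝ) < 8), mul_one_div]
  exact mul_le_of_le_one_right (by positivity) (by linarith)

lemma summable_abs_serCoeff_mul_pow (hlam : 0 ≤ lam) (ht : 0 ≤ t) {m : ℕ} (hm : m ≤ 2) :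
    Summable fun k => |serCoeff lam t k * oddFreq k ^ m| := by
  refine ((summable_one_div_oddFreq_pow (m := 4 - m) (by lia)).mul_left 8).of_nonneg_of_le
    (fun k => abs_nonneg _) fun k => ?_
  have ha := oddFreq_pos k
  rw [abs_mul, abs_of_pos (pow_pos ha m)]
  refine (mul_le_mul_of_nonneg_right (abs_serCoeff_le hlam ht k) (by positivity)).trans_eq ?_
  rw [pow_sub₀ _ ha.ne' (by lia)]
  field_simp

lemma summable_abs_serCoeff (hlam : 0 ≤ lam) (ht : 0 ≤ t) :
    Summable fun k => |serCoeff lam t k| := by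
  simpa using summable_abs_serCoeff_mul_pow hlam ht (m := 0) (by lia)

lemma summable_abs_serCoeff_mul (hlam : 0 ≤ lam) (ht : 0 ≤ t) :
    Summable fun k => |serCoeff lam t k * oddFreq k| := by
  simpa using summable_abs_serCoeff_mul_pow hlam ht (m := 1) (by lia)

lemma abs_serTerm_le (s : ℝ) (k : ℕ) : |serTerm lam t s k| ≤ |serCoeff lam t k| := by
  rw [serTerm_eq, abs_mul]
  exact mul_le_of_le_one_right (abs_nonneg _) (abs_cos_le_one _)

lemma summable_abs_serTerm (hlam : 0 ≤ lam) (ht : 0 ≤ t) (s : ℝ) :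
    Summable fun k => |serTerm lam t s k| :=
  (summable_abs_serCoeff hlam ht).of_nonneg_of_le (fun _ => abs_nonneg _) (abs_serTerm_le s)

lemma hasDerivAt_uSol_space (hlam : 0 ≤ lam) (ht : 0 ≤ t) (s : ℝ) :
    HasDerivAt (fun x => uSol lam t x)
      (1 / lam * ∑' k, -(serCoeff lam t k * oddFreq k) * sin (oddFreq k * s)) s :=
  ((hasDerivAt_tsum_mul_cos (summable_abs_serCoeff hlam ht)
    (summable_abs_serCoeff_mul hlam ht) s).const_mul (1 / lam)).const_add (t - 1)

lemma deriv_uSol_space (hlam : 0 ≤ lam) (ht : 0 ≤ t) :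
    deriv (fun x => uSol lam t x) =
      fun s => 1 / lam * ∑' k, -(serCoeff lam t k * oddFreq k) * sin (oddFreq k * s) :=
  funext fun s => (hasDerivAt_uSol_space hlam ht s).deriv

lemma summable_abs_neg_serCoeff_mul_mul (hlam : 0 ≤ lam) (ht : 0 ≤ t) :
    Summable fun k => |-(serCoeff lam t k * oddFreq k) * oddFreq k| := by
  simpa only [neg_mul, abs_neg, mul_assoc, pow_two] using
    summable_abs_serCoeff_mul_pow hlam ht (m := 2) le_rfl

lemma hasDerivAt_deriv_uSol_space (hlam : 0 ≤ lam) (ht : 0 ≤ t) (s : ℝ) :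
    HasDerivAt (deriv fun x => uSol lam t x)
      (1 / lam * ∑' k, -(serCoeff lam t k * oddFreq k) * oddFreq k * cos (oddFreq k * s)) s := by
  rw [deriv_uSol_space hlam ht]
  exact (hasDerivAt_tsum_mul_sin (summable_abs_neg_serCoeff_mul_mul hlam ht) s).const_mul _

lemma contDiff_uSol_space (hlam : 0 ≤ lam) (ht : 0 ≤ t) :
    ContDiff ℝ 2 fun s => uSol lam t s := by
  rw [show (2 : WithTop ℕ∞) = 1 + 1 by norm_num, contDiff_succ_iff_deriv]
  refine ⟨fun s => (hasDerivAt_uSol_space hlam ht s).differentiableAt, by simp,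
    contDiff_one_iff_deriv.2
      ⟨fun s => (hasDerivAt_deriv_uSol_space hlam ht s).differentiableAt, ?_⟩⟩
  rw [funext fun s => (hasDerivAt_deriv_uSol_space hlam ht s).deriv]
  exact continuous_const.mul
    (continuous_tsum_mul_cos (summable_abs_neg_serCoeff_mul_mul hlam ht))

lemma hasDerivAt_serCoeff (k : ℕ) :
    HasDerivAt (fun r => serCoeff lam r k)
      (-8 * lam * (1 / oddFreq k ^ 2) * exp (-(lam * oddFreq k ^ 2 * t))) t := by
  have h := ((((hasDerivAt_id t).const_mul (lam * oddFreq k ^ 2)).fun_neg.exp).const_sub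
    1).const_mul ((-8) / oddFreq k ^ 4)
  convert! h using 1
  have := oddFreq_pos k
  simp only [id_eq]
  field_simp

lemma hasDerivAt_uSol_time (hlam : 0 ≤ lam) (ht : 0 < t) (s : ℝ) :
    HasDerivAt (fun r => uSol lam r s)
      (1 + 1 / lam * ∑' k, -8 * lam * (1 / oddFreq k ^ 2) * exp (-(lam * oddFreq k ^ 2 * t)) *
        cos (oddFreq k * s)) t := by
  have hsum : HasDerivAt (fun r => ∑' k, serTerm lam r s k) _ t :=
    hasDerivAt_tsum_of_isPreconnected (t := Ioi 0)
      (g' := fun k r => -8 * lam * (1 / oddFreq k ^ 2) * exp (-(lam * oddFreq k ^ 2 * r)) *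
        cos (oddFreq k * s))
      ((summable_one_div_oddFreq_pow le_rfl).mul_left (8 * lam)) isOpen_Ioi isPreconnected_Ioi
      (fun k r _ => (hasDerivAt_serCoeff k).mul_const _) (fun k r hr => ?_) ht
      (summable_abs_serTerm hlam ht.le s).of_abs ht
  · exact ((hasDerivAt_id t).sub_const 1).add (hsum.const_mul (1 / lam))
  · have := oddFreq_pos k
    have hr' : 0 < r := hr
    have h1 : exp (-(lam * oddFreq k ^ 2 * r)) ≤ 1 := by
      rw [exp_le_one_iff, neg_nonpos]
      positivity
    have habs : |-8 * lam * (1 / oddFreq k ^ 2)| = 8 * lam * (1 / oddFreq k ^ 2) := by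
      rw [neg_mul, neg_mul, abs_neg, abs_of_nonneg (by positivity)]
    rw [norm_eq_abs, abs_mul, abs_mul, habs, abs_of_pos (exp_pos _), mul_assoc]
    exact mul_le_of_le_one_right (by positivity)
      (mul_le_one₀ h1 (abs_nonneg _) (abs_cos_le_one _))

lemma uSol_heat_equation (hlam : 0 < lam) (ht : 0 < t) {s : ℝ} (hs : s ∈ Icc (0 : ℝ) 1) :
    deriv (fun r => uSol lam r s) t - lam * deriv (deriv fun x => uSol lam t x) s = 2 * s := by
  rw [(hasDerivAt_uSol_time hlam.le ht s).deriv,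
    (hasDerivAt_deriv_uSol_space hlam.le ht.le s).deriv]
  have hspace : Summable fun k =>
      -(serCoeff lam t k * oddFreq k) * oddFreq k * cos (oddFreq k * s) := by
    refine .of_abs <| (summable_abs_neg_serCoeff_mul_mul hlam.le ht.le).of_nonneg_of_le
      (fun _ => abs_nonneg _) fun k => ?_
    rw [abs_mul]
    exact mul_le_of_le_one_right (abs_nonneg _) (abs_cos_le_one _)
  have htime : ∀ k, -8 * lam * (1 / oddFreq k ^ 2) * exp (-(lam * oddFreq k ^ 2 * t)) *
      cos (oddFreq k * s) = lam * (-(serCoeff lam t k * oddFreq k) * oddFreq k *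
        cos (oddFreq k * s)) - 8 * lam * (1 / oddFreq k ^ 2 * cos (oddFreq k * s)) := by
    intro k
    have := oddFreq_pos k
    unfold serCoeff
    field_simp
    ring
  have hcos := hasSum_cos_oddFreq hs
  rw [tsum_congr htime, (hspace.mul_left lam).tsum_sub (hcos.summable.mul_left (8 * lam)),
    tsum_mul_left, tsum_mul_left, hcos.tsum_eq]
  generalize ∑' k, -(serCoeff lam t k * oddFreq k) * oddFreq k * cos (oddFreq k * s) = S
  field_simp
  ring

end Coefficients

lemma sin_oddFreq (k : ℕ) : sin (oddFreq k) = 0 := by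
  simpa [oddFreq] using sin_nat_mul_pi (2 * k + 1)

/-- For `λ > 0`: (i) the series converges absolutely (for every `t ≥ 0, s`)
and uniformly in `s ∈ [0,1]`, and `u(0,·) ≡ -1`; (ii) for every `t > 0`, `u(t,·)` is `C²`
on `[0,1]`, `u(·,s)` is differentiable in `t`, and `∂ₜu - λ∂²ₛₛu = 2s` on `(0,1)`;
(iii) the homogeneous Neumann boundary conditions `∂ₛu(t,0) = ∂ₛu(t,1) = 0` hold for `t > 0`. -/
theorem uSol_solves_heat_equation (lam : ℝ) (hlam : 0 < lam) :
    (∀ t : ℝ, 0 ≤ t → ∀ s : ℝ, Summable (fun k : ℕ => |serTerm lam t s k|)) ∧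
    (∀ t : ℝ, 0 ≤ t → TendstoUniformlyOn
        (fun N s => ∑ k ∈ Finset.range N, serTerm lam t s k)
        (fun s => ∑' k : ℕ, serTerm lam t s k) Filter.atTop (Set.Icc 0 1)) ∧
    (∀ s ∈ Set.Icc (0:ℝ) 1, uSol lam 0 s = -1) ∧
    (∀ t : ℝ, 0 < t →
      ContDiffOn ℝ 2 (fun s => uSol lam t s) (Set.Icc 0 1) ∧
      (∀ s ∈ Set.Icc (0:ℝ) 1, DifferentiableAt ℝ (fun r => uSol lam r s) t) ∧
      (∀ s ∈ Set.Ioo (0:ℝ) 1,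
        deriv (fun r => uSol lam r s) t
          - lam * deriv (deriv (fun x => uSol lam t x)) s = 2*s)) ∧
    (∀ t : ℝ, 0 < t →
      deriv (fun x => uSol lam t x) 0 = 0 ∧ deriv (fun x => uSol lam t x) 1 = 0) := by
  refine ⟨fun t ht s => summable_abs_serTerm hlam.le ht s, fun t ht => ?_, fun s _ => ?_,
    fun t ht => ⟨(contDiff_uSol_space hlam.le ht.le).contDiffOn,
      fun s _ => (hasDerivAt_uSol_time hlam.le ht s).differentiableAt,
      fun s hs => uSol_heat_equation hlam ht (Ioo_subset_Icc_self hs)⟩,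
    fun t ht => ?_⟩
  · exact tendstoUniformlyOn_tsum_nat (summable_abs_serCoeff hlam.le ht)
      fun k s _ => abs_serTerm_le s k
  · simp [uSol, serTerm]
  · rw [deriv_uSol_space hlam.le ht.le]
    simp [sin_oddFreq]
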